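/- Fix constants c > 0 and E ≥ 0. Let S be a finite set of size n and let h be a random injection from S into (0,1] such that for every p ∈ (0,1] and every 0 < ε ≤ 1, writing X^{<p} = |{x ∈ S : h(x) < p}| and μ_p = p·n, one has Pr[|X^{<p} − μ_p| ≥ ε·μ_p] ≤ 2·exp(−c·ε²·μ_p) + E. Let 1 ≤ k ≤ n, let h_(k) be the k-th smallest hash value of S, and let n̂ = k/h_(k). Then there is a constant c' > 0 depending only on c (one may take c' = c/2) such that for every 0 < ε < 1 with k/((1−ε)n) ≤ 1, Pr[|n̂ − n| > ε·n] ≤ 4·exp(−c'·k·ε²) + 2E. -/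

import Mathlib

open MeasureTheory ProbabilityTheory

/-- The `k`-th smallest value among `{h x : x ∈ S}` (for `1 ≤ k ≤ |S|` and `h`
injective on `S`): the `(k-1)`-st entry of the increasingly sorted list of hash values. -/
noncomputable def kthSmallest {α : Type*} (S : Finset α) (h : α → ℝ) (k : ℕ) : ℝ :=
  ((S.image h).sort (· ≤ ·)).getD (k - 1) 0

/-- `kthSmallest` as a value of the increasing enumeration of the image. -/
lemma kthSmallest_eq_orderEmbOfFin {α : Type*} {S : Finset α} {f : α → ℝ} {k n : ℕ}
    (hn : (S.image f).card = n) (hk : k - 1 < n) :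
    kthSmallest S f k = (S.image f).orderEmbOfFin hn ⟨k - 1, hk⟩ := by
  rw [Finset.orderEmbOfFin_apply, kthSmallest, List.getD_eq_getElem]
  rfl

lemma kthSmallest_mem_image {α : Type*} {S : Finset α} {f : α → ℝ} {k : ℕ}
    (hf : Set.InjOn f S) (hk1 : 1 ≤ k) (hkn : k ≤ S.card) :
    kthSmallest S f k ∈ S.image f := by
  rw [kthSmallest_eq_orderEmbOfFin (Finset.card_image_of_injOn hf) (by lia)]
  exact Finset.orderEmbOfFin_mem _ _ _

lemma card_filter_image_lt {α : Type*} {S : Finset α} {f : α → ℝ}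
    (hf : Set.InjOn f S) (p : ℝ) :
    ((S.image f).filter (· < p)).card = (S.filter fun x => f x < p).card := by
  rw [Finset.filter_image]
  exact Finset.card_image_of_injOn (hf.mono (Finset.filter_subset _ S))

lemma le_card_filter_of_kthSmallest_lt {α : Type*} {S : Finset α} {f : α → ℝ} {k : ℕ}
    (hf : Set.InjOn f S) (hk1 : 1 ≤ k) (hkn : k ≤ S.card) {p : ℝ}
    (hp : kthSmallest S f k < p) : k ≤ (S.filter fun x => f x < p).card := by
  have hn := Finset.card_image_of_injOn hf
  rw [kthSmallest_eq_orderEmbOfFin hn (by lia)] at hp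
  rw [← card_filter_image_lt hf]
  set e := (S.image f).orderEmbOfFin hn
  calc k = ((Finset.Iic (⟨k - 1, by lia⟩ : Fin S.card)).map e.toEmbedding).card := by
        rw [Finset.card_map, Fin.card_Iic]
        exact (Nat.sub_add_cancel hk1).symm
    _ ≤ _ := Finset.card_le_card fun y hy => by
        obtain ⟨i, hi, rfl⟩ := Finset.mem_map.1 hy
        exact Finset.mem_filter.2 ⟨Finset.orderEmbOfFin_mem _ hn i,
          (e.monotone (Finset.mem_Iic.1 hi)).trans_lt hp⟩

lemma card_filter_lt_of_le_kthSmallest {α : Type*} {S : Finset α} {f : α → ℝ} {k : ℕ}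
    (hf : Set.InjOn f S) (hk1 : 1 ≤ k) (hkn : k ≤ S.card) {p : ℝ}
    (hp : p ≤ kthSmallest S f k) : (S.filter fun x => f x < p).card < k := by
  have hn := Finset.card_image_of_injOn hf
  rw [kthSmallest_eq_orderEmbOfFin hn (by lia)] at hp
  rw [← card_filter_image_lt hf]
  set e := (S.image f).orderEmbOfFin hn with he
  have hsub : (S.image f).filter (· < p) ⊆
      (Finset.Iio (⟨k - 1, by lia⟩ : Fin S.card)).map e.toEmbedding := fun y hy => by
    obtain ⟨hyT, hyp⟩ := Finset.mem_filter.1 hy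
    obtain ⟨i, rfl⟩ : y ∈ Set.range e := by
      rw [he, Finset.range_orderEmbOfFin]
      exact hyT
    exact Finset.mem_map.2 ⟨i, Finset.mem_Iio.2 (e.lt_iff_lt.1 (hyp.trans_le hp)), rfl⟩
  have hcard := Finset.card_le_card hsub
  rw [Finset.card_map, Fin.card_Iio] at hcard
  exact hcard.trans_lt (Nat.sub_one_lt_of_lt hk1)

/-- Let `h` be a random injection of `S` (of size `n`) into `(0,1]`
which is `(c,E)`-strongly concentrated: for every `p ∈ (0,1]` and `0 < ε ≤ 1`, the count
`X^{<p}` of elements of `S` hashing below `p` satisfies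
`Pr[|X^{<p} − p·n| ≥ ε·p·n] ≤ 2·exp(−c·ε²·p·n) + E`.
Then, with `c' = c/2`, the bottom-`k` estimator `n̂ = k/h_(k)` satisfies, for every
`0 < ε < 1` with `k/((1−ε)n) ≤ 1`,
`Pr[|n̂ − n| > ε·n] ≤ 4·exp(−c'·k·ε²) + 2·E`. -/
theorem stmt_10 {Ω : Type*} [MeasurableSpace Ω] (μpr : Measure Ω) [IsProbabilityMeasure μpr]
    {α : Type*} (S : Finset α) (h : α → Ω → ℝ)
    (c E : ℝ) (hc : 0 < c) (hE : 0 ≤ E)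
    (hinj : ∀ ω, Set.InjOn (fun x => h x ω) S)
    (hrange : ∀ ω, ∀ x ∈ S, h x ω ∈ Set.Ioc (0 : ℝ) 1)
    (hconc : ∀ p : ℝ, p ∈ Set.Ioc (0 : ℝ) 1 → ∀ ε : ℝ, 0 < ε → ε ≤ 1 →
      μpr {ω | ε * (p * S.card) ≤
          |((S.filter fun x => h x ω < p).card : ℝ) - p * S.card|} ≤
        ENNReal.ofReal (2 * Real.exp (-(c * ε ^ 2 * (p * S.card))) + E))
    (k : ℕ) (hk1 : 1 ≤ k) (hkn : k ≤ S.card)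
    (ε : ℝ) (hε0 : 0 < ε) (hε1 : ε < 1) (hp : (k : ℝ) / ((1 - ε) * S.card) ≤ 1) :
    μpr {ω | ε * S.card < |(k : ℝ) / kthSmallest S (fun x => h x ω) k - S.card|} ≤
      ENNReal.ofReal (4 * Real.exp (-(c / 2 * k * ε ^ 2)) + 2 * E) := by
  have hk : (0 : ℝ) < k := by exact_mod_cast hk1
  have hkn' : (k : ℝ) ≤ S.card := by exact_mod_cast hkn
  have hn : (0 : ℝ) < S.card := hk.trans_le hkn'
  have h1 : (0 : ℝ) < 1 - ε := by linarith
  set n : ℝ := (S.card : ℝ)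
  have hp₁ : k / ((1 + ε) * n) ∈ Set.Ioc (0 : ℝ) 1 :=
    ⟨by positivity, (div_le_one (by positivity)).2 (by nlinarith)⟩
  have hp₂ : k / ((1 - ε) * n) ∈ Set.Ioc (0 : ℝ) 1 := ⟨by positivity, hp⟩
  have hm₁ : k / ((1 + ε) * n) * n = k / (1 + ε) := by field_simp
  have hm₂ : k / ((1 - ε) * n) * n = k / (1 - ε) := by field_simp
  have htail : ∀ m : ℝ, k / 2 ≤ m →
      ENNReal.ofReal (2 * Real.exp (-(c * ε ^ 2 * m)) + E) ≤
        ENNReal.ofReal (2 * Real.exp (-(c / 2 * k * ε ^ 2)) + E) := fun m hm => by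
    have : c / 2 * k * ε ^ 2 ≤ c * ε ^ 2 * m := calc
      c / 2 * k * ε ^ 2 = c * ε ^ 2 * (k / 2) := by ring
      _ ≤ c * ε ^ 2 * m := by gcongr
    gcongr ENNReal.ofReal (2 * Real.exp (-?_) + E)
  have hc₁ := (hconc _ hp₁ ε hε0 hε1.le).trans
    (htail _ (by rw [hm₁]; gcongr; linarith))
  have hc₂ := (hconc _ hp₂ ε hε0 hε1.le).trans
    (htail _ (by rw [hm₂]; gcongr; linarith))
  rw [hm₁] at hc₁
  rw [hm₂] at hc₂
  rw [show 4 * Real.exp (-(c / 2 * k * ε ^ 2)) + 2 * E =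
    (2 * Real.exp (-(c / 2 * k * ε ^ 2)) + E) + (2 * Real.exp (-(c / 2 * k * ε ^ 2)) + E) by ring,
    ENNReal.ofReal_add (by positivity) (by positivity)]
  refine (measure_mono fun ω hω => ?_).trans
    ((measure_union_le _ _).trans (add_le_add hc₁ hc₂))
  have hpos : 0 < kthSmallest S (fun x => h x ω) k := by
    obtain ⟨x, hx, hxk⟩ := Finset.mem_image.1 (kthSmallest_mem_image (hinj ω) hk1 hkn)
    exact hxk ▸ (hrange ω x hx).1
  rcases lt_abs.1 (Set.mem_ofPred.1 hω) with hover | hunder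
  · left
    have hlt : kthSmallest S (fun x => h x ω) k < k / ((1 + ε) * n) := by
      rw [lt_div_iff₀ (by positivity), mul_comm, ← lt_div_iff₀ hpos]
      linarith
    have hcount : (k : ℝ) ≤ (S.filter fun x => h x ω < k / ((1 + ε) * n)).card := by
      exact_mod_cast le_card_filter_of_kthSmallest_lt (hinj ω) hk1 hkn hlt
    have hsplit : ε * (k / (1 + ε)) = k - k / (1 + ε) := by field_simp; ring
    rw [Set.mem_ofPred, hsplit]
    exact le_abs.2 (Or.inl (by linarith))
  · right
    have hlt : k / ((1 - ε) * n) < kthSmallest S (fun x => h x ω) k := by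
      rw [div_lt_iff₀ (by positivity), mul_comm, ← div_lt_iff₀ hpos]
      linarith
    have hcount : ((S.filter fun x => h x ω < k / ((1 - ε) * n)).card : ℝ) ≤ k := by
      exact_mod_cast (card_filter_lt_of_le_kthSmallest (hinj ω) hk1 hkn hlt.le).le
    have hsplit : ε * (k / (1 - ε)) = k / (1 - ε) - k := by field_simp; ring
    rw [Set.mem_ofPred, hsplit]
    exact le_abs.2 (Or.inr (by linarith))
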